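/- Let C₁ ⊂ C₂ ⊆ F_q^n be linear codes with dim C₁ = k₁, dim C₂ = k₁ + k, k ≥ 1, and suppose every codeword in C₁^⊥ \ C₂^⊥ has Hamming weight at least d. Then there exists a linear [k + k₁, k] code over F_q with minimum distance at least d. -/

import Mathlib

open Finset

def dualCode {F : Type} [Field F] {n : ℕ} (C : Submodule F (Fin n → F)) :
    Submodule F (Fin n → F) where
  carrier := {v | ∀ w ∈ C, ∑ i, v i * w i = 0}
  add_mem' := by
    intro a b ha hb w hw
    simp only [Pi.add_apply, add_mul, Finset.sum_add_distrib, ha w hw, hb w hw, add_zero]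
  zero_mem' := by intro w hw; simp
  smul_mem' := by
    intro c a ha w hw
    simp only [Pi.smul_apply, smul_eq_mul, mul_assoc, ← Finset.mul_sum, ha w hw, mul_zero]

theorem span_range_proj_domRestrict {F ι : Type*} [Field F] [Fintype ι]
    (C : Submodule F (ι → F)) :
    Submodule.span F (Set.range fun i : ι => (LinearMap.proj i : (ι → F) →ₗ[F] F).domRestrict C)
      = ⊤ := by
  classical
  refine eq_top_iff.2 fun f _ => ?_
  obtain ⟨g, rfl⟩ := f.exists_extend
  have hg : g ∘ₗ C.subtype =
      ∑ i, g (fun j => if i = j then 1 else 0) •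
        (LinearMap.proj i : (ι → F) →ₗ[F] F).domRestrict C := by
    ext w
    simp [LinearMap.pi_apply_eq_sum_univ g (w : ι → F), mul_comm]
  rw [hg]
  exact Submodule.sum_mem _ fun i _ => Submodule.smul_mem _ _ (Submodule.subset_span ⟨i, rfl⟩)

/-- Every code `C` has an information set, given as an enumeration `g` of coordinates. -/
theorem exists_information_set {F ι : Type*} [Field F] [Fintype ι]
    (C : Submodule F (ι → F)) {m : ℕ} (hm : Module.finrank F C = m) :
    ∃ g : Fin m → ι,
      LinearIndependent F
        (fun i => (LinearMap.proj (g i) : (ι → F) →ₗ[F] F).domRestrict C) ∧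
      Submodule.span F
        (Set.range fun i => (LinearMap.proj (g i) : (ι → F) →ₗ[F] F).domRestrict C) = ⊤ := by
  have hspan := span_range_proj_domRestrict C
  obtain ⟨f, hf, hfspan, hli⟩ := Submodule.exists_fun_fin_finrank_span_eq F
    (Set.range fun i : ι => (LinearMap.proj i : (ι → F) →ₗ[F] F).domRestrict C)
  have hrank : Module.finrank F (Submodule.span F
      (Set.range fun i : ι => (LinearMap.proj i : (ι → F) →ₗ[F] F).domRestrict C)) = m := by
    rw [hspan, finrank_top, ← hm]
    exact Subspace.dual_finrank_eq
  subst hrank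
  choose g hg using hf
  have hfg : (fun i => (LinearMap.proj (g i) : (ι → F) →ₗ[F] F).domRestrict C) = f := funext hg
  exact ⟨g, hfg ▸ hli, hfg ▸ hfspan.trans hspan⟩

theorem hammingNorm_extend_zero {F ι κ : Type*} [Zero F] [DecidableEq F] [Fintype ι] [Fintype κ]
    {g : κ → ι} (hg : Function.Injective g) (v : κ → F) :
    hammingNorm (Function.extend g v 0) = hammingNorm v := by
  classical
  unfold hammingNorm
  rw [← Finset.card_image_of_injective _ hg]
  congr 1
  ext j
  by_cases hj : ∃ i, g i = j
  · obtain ⟨i, rfl⟩ := hj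
    simp [hg.extend_apply, hg.eq_iff]
  · simp only [Finset.mem_filter, Finset.mem_univ, true_and, Finset.mem_image,
      Function.extend_apply' _ _ _ hj, Pi.zero_apply, ne_eq, not_true_eq_false, false_iff]
    exact fun ⟨i, _, h⟩ => hj ⟨i, h⟩

theorem sum_extend_zero_mul {F ι κ : Type*} [Semiring F] [Fintype ι] [Fintype κ]
    {g : κ → ι} (hg : Function.Injective g) (v : κ → F) (w : ι → F) :
    ∑ j, Function.extend g v 0 j * w j = ∑ i, v i * w (g i) := by
  refine (Fintype.sum_of_injective g hg _ _ (fun j hj => ?_) fun i => ?_).symm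
  · rw [Function.extend_apply' _ _ _ hj, Pi.zero_apply, zero_mul]
  · rw [hg.extend_apply]

theorem stmt_9 (q n k k₁ : ℕ) (F : Type) [Field F] [Fintype F] [DecidableEq F]
    (hF : Fintype.card F = q)
    (C₁ C₂ : Submodule F (Fin n → F)) (hsub : C₁ < C₂)
    (hk₁ : Module.finrank F C₁ = k₁) (hk₂ : Module.finrank F C₂ = k₁ + k) (hk : 1 ≤ k)
    (d : ℕ) (hd : ∀ v ∈ dualCode C₁, v ∉ dualCode C₂ → d ≤ hammingNorm v) :
    ∃ D : Submodule F (Fin (k + k₁) → F), Module.finrank F D = k ∧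
      ∀ v ∈ D, v ≠ 0 → d ≤ hammingNorm v := by
  obtain ⟨g, hli, hspan⟩ := exists_information_set C₂ (hk₂.trans (add_comm k₁ k))
  have hg : Function.Injective g := fun i j hij => hli.injective (by simp only [hij])
  let φ := Fintype.linearCombination F
    fun i => (LinearMap.proj (g i) : (Fin n → F) →ₗ[F] F).domRestrict C₂
  let ρ := (Submodule.inclusion hsub.le).dualMap
  have hφ : Function.Surjective φ := by
    rw [← LinearMap.range_eq_top, Fintype.range_linearCombination, hspan]
  have hρ : Function.Surjective ρ :=
    LinearMap.dualMap_surjective_of_injective (Submodule.inclusion_injective hsub.le)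
  have hφ_apply : ∀ v w, φ v w = ∑ i, v i * (w : Fin n → F) (g i) := fun v w => by
    simp [φ, Fintype.linearCombination_apply]
  refine ⟨LinearMap.ker (ρ ∘ₗ φ), ?_, fun v hv hv0 => ?_⟩
  · have hrank := LinearMap.finrank_range_add_finrank_ker (ρ ∘ₗ φ)
    have hdual : Module.finrank F (Module.Dual F C₁) = k₁ := Subspace.dual_finrank_eq.trans hk₁
    have hsurj : Function.Surjective (ρ ∘ₗ φ) := by
      rw [LinearMap.coe_comp]
      exact hρ.comp hφ
    rw [LinearMap.range_eq_top.2 hsurj, finrank_top, hdual, Module.finrank_fin_fun] at hrank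
    omega
  · rw [← hammingNorm_extend_zero hg]
    refine hd _ (fun w hw => ?_) fun hdual => hv0 ?_
    · rw [sum_extend_zero_mul hg]
      have := LinearMap.congr_fun hv ⟨w, hw⟩
      exact (hφ_apply v ⟨w, hsub.le hw⟩).symm.trans this
    · have hzero : φ v = 0 := LinearMap.ext fun w => by
        rw [hφ_apply, ← sum_extend_zero_mul hg]
        exact hdual w w.2
      exact funext (Fintype.linearIndependent_iff.1 hli v hzero)
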